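/- Let Σ = (x̃,ρ,B̃) be an acyclic generalized seed ordered so that b_{ij} ≥ 0 whenever n ≥ i > j ≥ 1, let ℙ be the multiplicative group generated by x_{n+1},…,x_m and ℤℙ its group ring. For k ∈ [1,n], set A^{(k)} = x_k x_k^{(k)} − ∏_{j ∈ [n+1,m], b^{(k−1)}_{jk} < 0} x_j^{−b^{(k−1)}_{jk}}, where x_k^{(k)} is the k-th cluster variable of Σ^{(k)} = μ_k⋯μ_1(Σ) and B̃^{(k−1)} = μ_{k−1}⋯μ_1(B̃). Then for any i ∈ [k+1,n] with b_{ik} > 0, one has x_i^{-1} A^{(k)} ∈ ℤℙ[x_1^{(1)}, …, x_{k−1}^{(k−1)}, x_{k+1}, …, x_n]. -/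

import Mathlib

open Finset

namespace GCA

/-- Ambient field: the field of rational functions `ℚ(x₁,…,x_m)`. -/
abbrev K (m : ℕ) : Type := FractionRing (MvPolynomial (Fin m) ℚ)

/-- The variables `x₁,…,x_m` inside the ambient field. -/
noncomputable def xv (m : ℕ) (j : Fin m) : K m :=
  algebraMap (MvPolynomial (Fin m) ℚ) (K m) (MvPolynomial.X j)

/-- The coefficient ring `ℤℙ`: the Laurent polynomial ring generated over `ℤ`
by the frozen variables `x_{n+1},…,x_m` and their inverses, as a subalgebra of `K m`. -/
noncomputable def ZP (m n : ℕ) : Subalgebra ℤ (K m) :=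
  Algebra.adjoin ℤ {y | ∃ j : Fin m, n ≤ (j : ℕ) ∧ (y = xv m j ∨ y = (xv m j)⁻¹)}

/-- A (generalized) seed datum: the extended cluster, strings, and the exchange matrix. -/
structure Seed (m n : ℕ) where
  x : Fin m → K m
  ρ : Fin n → ℕ → K m
  B : Matrix (Fin m) (Fin n) ℤ

variable {m n : ℕ}

/-- The exponent `⌊[rβ]₊⌋ + ⌊[−(d−r)β]₊⌋` where `β = b/d`. -/
def mutExp (d : ℕ) (b : ℤ) (r : ℕ) : ℤ :=
  ⌊max ((r : ℚ) * b / d) 0⌋ + ⌊max (-(((d : ℚ) - r) * b / d)) 0⌋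

/-- Matrix mutation in direction `i` of an `m × n` exchange matrix. -/
def matMut (hmn : n ≤ m) (i : Fin n) (B : Matrix (Fin m) (Fin n) ℤ) :
    Matrix (Fin m) (Fin n) ℤ := fun k l =>
  if k = Fin.castLE hmn i ∨ l = i then -B k l
  else B k l + (|B k i| * B (Fin.castLE hmn i) l + B k i * |B (Fin.castLE hmn i) l|) / 2

/-- The exchanged cluster variable `x'_i` of a seed. -/
noncomputable def exchangeVar (hmn : n ≤ m) (d : Fin n → ℕ) (S : Seed m n) (i : Fin n) :
    K m :=
  (S.x (Fin.castLE hmn i))⁻¹ *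
    ∑ r ∈ Finset.range (d i + 1),
      S.ρ i r * ∏ k : Fin m, S.x k ^ mutExp (d i) (S.B k i) r

/-- Seed mutation in direction `i`. -/
noncomputable def Seed.mut (hmn : n ≤ m) (d : Fin n → ℕ) (i : Fin n) (S : Seed m n) :
    Seed m n where
  x := fun j => if j = Fin.castLE hmn i then exchangeVar hmn d S i else S.x j
  ρ := fun j r => if j = i then S.ρ i (d i - r) else S.ρ j r
  B := matMut hmn i S.B

/-- Apply a finite sequence of mutations (left-most applied first). -/
noncomputable def mutSeq (hmn : n ≤ m) (d : Fin n → ℕ) : List (Fin n) → Seed m n → Seed m n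
  | [], S => S
  | i :: l, S => mutSeq hmn d l (Seed.mut hmn d i S)

/-- `seedUpTo hmn d S k = μ_k ⋯ μ_2 μ_1 (S)` (paper's direction `t ∈ [1,n]` is Lean's `t-1`). -/
noncomputable def seedUpTo (hmn : n ≤ m) (d : Fin n → ℕ) (S : Seed m n) : ℕ → Seed m n
  | 0 => S
  | k + 1 => if h : k < n then Seed.mut hmn d ⟨k, h⟩ (seedUpTo hmn d S k) else seedUpTo hmn d S k

/-- The initial seed whose cluster variables are the canonical variables of `ℚ(x₁,…,x_m)`. -/
noncomputable def initSeed (m n : ℕ) (ρ : Fin n → ℕ → K m) (B : Matrix (Fin m) (Fin n) ℤ) :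
    Seed m n := ⟨xv m, ρ, B⟩

/-- The principal part of `B` is skew-symmetrizable. -/
def SkewSymmetrizable (hmn : n ≤ m) (B : Matrix (Fin m) (Fin n) ℤ) : Prop :=
  ∃ D : Fin n → ℤ, (∀ i, 0 < D i) ∧
    ∀ i j : Fin n, D i * B (Fin.castLE hmn i) j = -(D j * B (Fin.castLE hmn j) i)

/-- `p` is a monomial in `ℤ[x_{n+1},…,x_m]`. -/
def IsFrozenMonomial (m n : ℕ) (p : K m) : Prop :=
  ∃ (c : ℤ) (e : Fin m → ℕ), (∀ j : Fin m, (j : ℕ) < n → e j = 0) ∧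
    p = (c : K m) * ∏ j : Fin m, xv m j ^ e j

/-- The defining conditions on the datum `(d, ρ, B)` of a generalized seed of geometric type. -/
structure SeedHyps (m n : ℕ) (hmn : n ≤ m) (d : Fin n → ℕ) (ρ : Fin n → ℕ → K m)
    (B : Matrix (Fin m) (Fin n) ℤ) : Prop where
  d_pos : ∀ i, 0 < d i
  d_dvd : ∀ i j : Fin n, (d i : ℤ) ∣ B (Fin.castLE hmn j) i
  skew : SkewSymmetrizable hmn B
  rho_zero : ∀ i, ρ i 0 = 1
  rho_top : ∀ i, ρ i (d i) = 1
  rho_mon : ∀ i r, r ≤ d i → IsFrozenMonomial m n (ρ i r)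

/-- The edge relation of the directed graph `Γ`: an edge from `i` to `j` iff `b_{ij} > 0`. -/
def GammaEdge (hmn : n ≤ m) (B : Matrix (Fin m) (Fin n) ℤ) (i j : Fin n) : Prop :=
  0 < B (Fin.castLE hmn i) j

/-- The directed graph `Γ` has no oriented cycle. -/
def Acyclic (hmn : n ≤ m) (B : Matrix (Fin m) (Fin n) ℤ) : Prop :=
  ∀ i : Fin n, ¬ Relation.TransGen (GammaEdge hmn B) i i

/-- The ordering normalization: `b_{ij} ≥ 0` whenever `n ≥ i > j ≥ 1`. -/
def Ordered (hmn : n ≤ m) (B : Matrix (Fin m) (Fin n) ℤ) : Prop :=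
  ∀ i j : Fin n, j < i → 0 ≤ B (Fin.castLE hmn i) j

/-- Divisibility inside a subset `R` of the ambient field. -/
def DvdIn (R : Set (K m)) (p u : K m) : Prop := ∃ z ∈ R, u = p * z

/-- `u` and `v` are coprime in `R`: every common divisor in `R` is a unit of `R`. -/
def CoprimeIn (R : Set (K m)) (u v : K m) : Prop :=
  ∀ p ∈ R, DvdIn R p u → DvdIn R p v → ∃ q ∈ R, p * q = 1

/-- The polynomial ring `ℤℙ[x₁,…,x_n]` as a subalgebra of `K m`. -/
noncomputable def polyRing (hmn : n ≤ m) : Subalgebra ℤ (K m) :=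
  Algebra.adjoin ℤ
    ({y | ∃ j : Fin m, n ≤ (j : ℕ) ∧ (y = xv m j ∨ y = (xv m j)⁻¹)} ∪
      {y | ∃ j : Fin n, y = xv m (Fin.castLE hmn j)})

/-- The seed is coprime: the exchange polynomials `x_i x'_i` are pairwise coprime
in `ℤℙ[x₁,…,x_n]`. -/
def CoprimeSeed (hmn : n ≤ m) (d : Fin n → ℕ) (S : Seed m n) : Prop :=
  ∀ i j : Fin n, i ≠ j →
    CoprimeIn (↑(polyRing hmn (m := m)) : Set (K m))
      (S.x (Fin.castLE hmn i) * exchangeVar hmn d S i)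
      (S.x (Fin.castLE hmn j) * exchangeVar hmn d S j)

/-- All cluster variables of all seeds mutation-equivalent to `S`. -/
noncomputable def clusterVars (hmn : n ≤ m) (d : Fin n → ℕ) (S : Seed m n) : Set (K m) :=
  {y | ∃ (L : List (Fin n)) (i : Fin n), y = (mutSeq hmn d L S).x (Fin.castLE hmn i)}

/-- The generalized cluster algebra `𝒜(x̃,ρ,B̃)` as a `ℤℙ`-subalgebra of `ℚ(x₁,…,x_m)`. -/
noncomputable def gca (hmn : n ≤ m) (d : Fin n → ℕ) (S : Seed m n) :
    Subalgebra (↥(ZP m n)) (K m) :=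
  Algebra.adjoin (↥(ZP m n)) (clusterVars hmn d S)

/-- The generalized projective cluster variable `x_i^{(n)}`. -/
noncomputable def projVar (hmn : n ≤ m) (d : Fin n → ℕ) (S : Seed m n) (i : Fin n) : K m :=
  (seedUpTo hmn d S n).x (Fin.castLE hmn i)

/-- The lower bound generalized cluster algebra
`ℒ^{(n)}(Σ) = ℤℙ[x₁, x₁^{(n)}, …, x_n, x_n^{(n)}]`. -/
noncomputable def lowerBound (hmn : n ≤ m) (d : Fin n → ℕ) (S : Seed m n) :
    Subalgebra (↥(ZP m n)) (K m) :=
  Algebra.adjoin (↥(ZP m n))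
    ({y | ∃ i : Fin n, y = S.x (Fin.castLE hmn i)} ∪
      {y | ∃ i : Fin n, y = projVar hmn d S i})

/-- Index type for standard monomials: exponent pairs with no product `x_i x'_i`. -/
def StdIdx (n : ℕ) : Type := {v : Fin n → ℕ × ℕ // ∀ i, (v i).1 = 0 ∨ (v i).2 = 0}

/-- The (projective) standard monomial attached to an exponent vector. -/
noncomputable def stdMon (x x' : Fin n → K m) (v : StdIdx n) : K m :=
  ∏ i : Fin n, x i ^ (v.1 i).1 * x' i ^ (v.1 i).2

/-- Lexicographic order on exponent vectors. -/
def lexLt (a b : Fin n → ℤ) : Prop :=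
  ∃ k : Fin n, a k < b k ∧ ∀ j : Fin n, j < k → a j = b j

/-- The Laurent monomial `x^a = x₁^{a₁} ⋯ x_n^{a_n}`. -/
noncomputable def xpow (hmn : n ≤ m) (a : Fin n → ℤ) : K m :=
  ∏ i : Fin n, xv m (Fin.castLE hmn i) ^ a i

/-- `x^a` is the first Laurent monomial of `Y` (with some nonzero leading
coefficient in `ℤℙ`): `Y = c_a x^a + Σ_v c_v x^v` with all `v ≺ a`. -/
def IsFirstMonomial (hmn : n ≤ m) (Y : K m) (a : Fin n → ℤ) : Prop :=
  ∃ (s : Finset (Fin n → ℤ)) (c : (Fin n → ℤ) → K m),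
    (∀ v, c v ∈ ZP m n) ∧ c a ≠ 0 ∧ (∀ v ∈ s, lexLt v a) ∧
    Y = c a * xpow hmn a + ∑ v ∈ s, c v * xpow hmn v

end GCA

namespace GCA

lemma xv_ne_zero (m : ℕ) (j : Fin m) : xv m j ≠ 0 := by
  unfold xv
  intro h
  rw [map_eq_zero_iff _ (IsFractionRing.injective (MvPolynomial (Fin m) ℚ) (K m))] at h
  exact MvPolynomial.X_ne_zero j h

lemma mutExp_nonneg (d : ℕ) (b : ℤ) (r : ℕ) : 0 ≤ mutExp d b r := by
  unfold mutExp
  have h1 : 0 ≤ ⌊max ((r : ℚ) * b / d) 0⌋ := Int.floor_nonneg.2 (le_max_right _ _)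
  have h2 : 0 ≤ ⌊max (-(((d : ℚ) - r) * b / d)) 0⌋ := Int.floor_nonneg.2 (le_max_right _ _)
  omega

lemma mutExp_zero (d : ℕ) (hd : 0 < d) (b : ℤ) : mutExp d b 0 = max (-b) 0 := by
  unfold mutExp
  have hd' : (d : ℚ) ≠ 0 := by positivity
  have e : -(((d : ℚ) - (0 : ℕ)) * b / d) = ((-b : ℤ) : ℚ) := by
    push_cast
    field_simp
    ring
  rw [e]
  have e2 : max (((-b : ℤ) : ℚ)) 0 = ((max (-b) 0 : ℤ) : ℚ) := by push_cast; rfl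
  rw [e2, Int.floor_intCast]
  simp

lemma mutExp_pos (d : ℕ) (hd : 0 < d) (b : ℤ) (hb : 0 < b) (hdb : (d : ℤ) ∣ b) (r : ℕ)
    (hr : 1 ≤ r) : 1 ≤ mutExp d b r := by
  unfold mutExp
  obtain ⟨c, rfl⟩ := hdb
  have hd' : (d : ℚ) ≠ 0 := by positivity
  have hc : 0 < c := by
    have : (0 : ℤ) < d := by exact_mod_cast hd
    exact pos_of_mul_pos_right hb this.le
  have h2 : 0 ≤ ⌊max (-(((d : ℚ) - r) * ((d * c : ℤ) : ℚ) / d)) 0⌋ :=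
    Int.floor_nonneg.2 (le_max_right _ _)
  have h1 : 1 ≤ ⌊max ((r : ℚ) * ((d * c : ℤ) : ℚ) / d) 0⌋ := by
    rw [Int.le_floor]
    refine le_trans ?_ (le_max_left _ _)
    have e : (r : ℚ) * ((d * c : ℤ) : ℚ) / d = ((r * c : ℤ) : ℚ) := by
      push_cast
      field_simp
    rw [e]
    have : (1 : ℤ) ≤ r * c := by
      have : (1 : ℤ) ≤ r := by exact_mod_cast hr
      nlinarith
    exact_mod_cast this
  omega

/-- Sign bookkeeping for the matrices after mutations in directions `< t`. -/
def sg (t a : ℕ) : ℤ := if a < t then -1 else 1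

section inv

variable (hmn : n ≤ m) (d : Fin n → ℕ) (ρ : Fin n → ℕ → K m) (B : Matrix (Fin m) (Fin n) ℤ)

lemma seedUpTo_succ (S : Seed m n) (t : ℕ) (h : t < n) :
    seedUpTo hmn d S (t + 1) = Seed.mut hmn d ⟨t, h⟩ (seedUpTo hmn d S t) := by
  simp [seedUpTo, h]

lemma x_ge (S : Seed m n) (t : ℕ) (ht : t ≤ n) (j : Fin m) (hj : t ≤ j) :
    (seedUpTo hmn d S t).x j = S.x j := by
  induction t with
  | zero => rfl
  | succ t ih =>
    rw [seedUpTo_succ hmn d S t (by omega)]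
    simp only [Seed.mut]
    rw [if_neg, ih (by omega) (by omega)]
    intro h
    have := congrArg Fin.val h
    simp at this
    omega

lemma x_lt (S : Seed m n) (t : ℕ) (ht : t ≤ n) (j : Fin n) (hj : j < t) :
    (seedUpTo hmn d S t).x (Fin.castLE hmn j) =
      (seedUpTo hmn d S (j + 1)).x (Fin.castLE hmn j) := by
  induction t with
  | zero => omega
  | succ t ih =>
    by_cases hjt : (j : ℕ) = t
    · rw [hjt]
    · rw [seedUpTo_succ hmn d S t (by omega)]
      simp only [Seed.mut]
      rw [if_neg, ih (by omega) (by omega)]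
      intro h
      have := congrArg Fin.val h
      simp at this
      omega

lemma rho_ge (S : Seed m n) (t : ℕ) (ht : t ≤ n) (j : Fin n) (hj : t ≤ j) :
    (seedUpTo hmn d S t).ρ j = S.ρ j := by
  induction t with
  | zero => rfl
  | succ t ih =>
    rw [seedUpTo_succ hmn d S t (by omega)]
    simp only [Seed.mut]
    rw [← ih (by omega) (by omega)]
    funext r
    rw [if_neg]
    intro h
    have := congrArg Fin.val h
    simp at this
    omega

lemma B_signs (S : Seed m n) (hdiag : ∀ a : Fin n, S.B (Fin.castLE hmn a) a = 0)
    (hpos : ∀ a b : Fin n, b < a → 0 ≤ S.B (Fin.castLE hmn a) b)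
    (hneg : ∀ a b : Fin n, a < b → S.B (Fin.castLE hmn a) b ≤ 0)
    (t : ℕ) (ht : t ≤ n) (a b : Fin n) :
    (seedUpTo hmn d S t).B (Fin.castLE hmn a) b = sg t a * sg t b * S.B (Fin.castLE hmn a) b := by
  induction t generalizing a b with
  | zero => simp [seedUpTo, sg]
  | succ t ih =>
    have htn : t < n := by omega
    have ih := fun a b => ih (by omega) a b
    rw [seedUpTo_succ hmn d S t htn]
    simp only [Seed.mut, matMut]
    have hinj : Fin.castLE hmn a = Fin.castLE hmn ⟨t, htn⟩ ↔ a = ⟨t, htn⟩ :=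
      (Fin.castLE_injective hmn).eq_iff
    simp only [hinj]
    by_cases hab : a = b
    · subst hab
      split_ifs with h
      · rw [ih, hdiag]; simp
      · simp only [or_self] at h
        rw [ih, ih, ih, hdiag]
        rcases lt_or_gt_of_ne (fun e => h (Fin.ext e) : (a : ℕ) ≠ t) with h1 | h1
        · have e1 := hneg a ⟨t, htn⟩ h1
          have e2 := hpos ⟨t, htn⟩ a h1
          simp only [sg, h1, lt_irrefl, if_true, if_false]
          rw [abs_of_nonneg (by linarith), abs_of_nonpos (by linarith)]
          ring_nf
          simp
        · have e1 := hpos a ⟨t, htn⟩ h1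
          have e2 := hneg ⟨t, htn⟩ a h1
          simp only [sg, h1.not_gt, lt_irrefl, if_false]
          rw [abs_of_nonneg (by linarith), abs_of_nonpos (by linarith)]
          ring_nf
          simp
    · by_cases h : a = ⟨t, htn⟩ ∨ b = ⟨t, htn⟩
      · rw [if_pos h, ih]
        rcases h with rfl | rfl
        · have hbt : (b : ℕ) ≠ t := fun e => hab (Fin.ext e.symm)
          have : (b : ℕ) < t + 1 ↔ (b : ℕ) < t := by omega
          simp [sg, this]
          split_ifs <;> simp
        · have hbt : (a : ℕ) ≠ t := fun e => hab (Fin.ext e)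
          have : (a : ℕ) < t + 1 ↔ (a : ℕ) < t := by omega
          simp [sg, this]
      · rw [if_neg h]
        push Not at h
        have hat : (a : ℕ) ≠ t := fun e => h.1 (Fin.ext e)
        have hbt : (b : ℕ) ≠ t := fun e => h.2 (Fin.ext e)
        have ea : sg (t + 1) a = sg t a := by
          have : (a : ℕ) < t + 1 ↔ (a : ℕ) < t := by omega
          simp [sg, this]
        have eb : sg (t + 1) b = sg t b := by
          have : (b : ℕ) < t + 1 ↔ (b : ℕ) < t := by omega
          simp [sg, this]
        have p1 : 0 ≤ sg t a * sg t t * S.B (Fin.castLE hmn a) ⟨t, htn⟩ := by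
          rcases lt_or_gt_of_ne hat with h1 | h1
          · have := hneg a ⟨t, htn⟩ h1
            simp [sg, h1, this]
          · have := hpos a ⟨t, htn⟩ h1
            simp [sg, h1.not_gt, this]
        have p2 : sg t t * sg t b * S.B (Fin.castLE hmn ⟨t, htn⟩) b ≤ 0 := by
          rcases lt_or_gt_of_ne hbt with h1 | h1
          · have := hpos ⟨t, htn⟩ b h1
            simpa [sg, h1] using this
          · have := hneg ⟨t, htn⟩ b h1
            simpa [sg, h1.not_gt] using this
        rw [ih, ih, ih, ea, eb, abs_of_nonneg p1, abs_of_nonpos p2]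
        ring_nf
        simp

end inv

lemma frozen_zpow_mem (j : Fin m) (hj : n ≤ (j : ℕ)) (e : ℤ) : xv m j ^ e ∈ ZP m n := by
  have h1 : xv m j ∈ ZP m n := Algebra.subset_adjoin ⟨j, hj, Or.inl rfl⟩
  have h2 : (xv m j)⁻¹ ∈ ZP m n := Algebra.subset_adjoin ⟨j, hj, Or.inr rfl⟩
  cases e with
  | ofNat e => simpa using pow_mem h1 e
  | negSucc e =>
    rw [zpow_negSucc, ← inv_pow]
    exact pow_mem h2 _

lemma frozenMonomial_mem {p : K m} (h : IsFrozenMonomial m n p) : p ∈ ZP m n := by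
  obtain ⟨c, e, he, rfl⟩ := h
  refine mul_mem (intCast_mem _ c) (prod_mem fun j _ => ?_)
  by_cases hj : (j : ℕ) < n
  · rw [he j hj, pow_zero]; exact one_mem _
  · have := frozen_zpow_mem (n := n) j (by omega) (e j)
    rwa [zpow_natCast] at this

end GCA

open GCA in
/-- For an acyclic ordered generalized seed, set
`A^{(k)} = x_k x_k^{(k)} − ∏_{j frozen, b^{(k−1)}_{jk}<0} x_j^{−b^{(k−1)}_{jk}}`. Then for
any `i ∈ [k+1,n]` with `b_{ik} > 0`, one has
`x_i^{-1} A^{(k)} ∈ ℤℙ[x₁^{(1)}, …, x_{k−1}^{(k−1)}, x_{k+1}, …, x_n]`. -/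
theorem inv_mul_A_mem {m n : ℕ} (hn : 1 ≤ n) (hmn : n ≤ m)
    (d : Fin n → ℕ) (ρ : Fin n → ℕ → K m) (B : Matrix (Fin m) (Fin n) ℤ)
    (hseed : SeedHyps m n hmn d ρ B)
    (hacyc : Acyclic hmn B) (hord : Ordered hmn B)
    (k i : Fin n) (hki : k < i) (hbik : 0 < B (Fin.castLE hmn i) k) :
    (xv m (Fin.castLE hmn i))⁻¹ *
        (xv m (Fin.castLE hmn k) *
            (seedUpTo hmn d (initSeed m n ρ B) ((k : ℕ) + 1)).x (Fin.castLE hmn k) -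
          ∏ j ∈ Finset.univ.filter (fun j : Fin m =>
              n ≤ (j : ℕ) ∧ (seedUpTo hmn d (initSeed m n ρ B) (k : ℕ)).B j k < 0),
            xv m j ^ (-(seedUpTo hmn d (initSeed m n ρ B) (k : ℕ)).B j k)) ∈
      Algebra.adjoin (↥(ZP m n))
        ({y | ∃ j : Fin n, j < k ∧
            y = (seedUpTo hmn d (initSeed m n ρ B) ((j : ℕ) + 1)).x (Fin.castLE hmn j)} ∪
          {y | ∃ j : Fin n, k < j ∧ y = xv m (Fin.castLE hmn j)}) := by
  obtain ⟨D, hD, hDB⟩ := hseed.skew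
  have hdiag : ∀ a : Fin n, B (Fin.castLE hmn a) a = 0 := by
    intro a
    have h1 := hDB a a
    have h2 := hD a
    have h3 : D a * B (Fin.castLE hmn a) a = 0 := by linarith
    exact (mul_eq_zero.1 h3).resolve_left h2.ne'
  have hneg : ∀ a b : Fin n, a < b → B (Fin.castLE hmn a) b ≤ 0 := by
    intro a b hab
    have h1 := hDB a b
    have h2 := mul_nonneg (hD b).le (hord b a hab)
    by_contra h3
    push Not at h3
    have := mul_pos (hD a) h3
    linarith
  have hBs := B_signs hmn d (initSeed m n ρ B) hdiag hord hneg k k.2.le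
  have hxge := x_ge hmn d (initSeed m n ρ B) k k.2.le
  have hxlt := x_lt hmn d (initSeed m n ρ B) k k.2.le
  have hρ := rho_ge hmn d (initSeed m n ρ B) k k.2.le k le_rfl
  have hstep : (seedUpTo hmn d (initSeed m n ρ B) ((k : ℕ) + 1)).x (Fin.castLE hmn k) =
      exchangeVar hmn d (seedUpTo hmn d (initSeed m n ρ B) k) k := by
    rw [seedUpTo_succ hmn d _ k k.2]
    simp [Seed.mut]
  rw [hstep]
  set A := Algebra.adjoin (↥(ZP m n))
        ({y | ∃ j : Fin n, j < k ∧
            y = (seedUpTo hmn d (initSeed m n ρ B) ((j : ℕ) + 1)).x (Fin.castLE hmn j)} ∪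
          {y | ∃ j : Fin n, k < j ∧ y = xv m (Fin.castLE hmn j)}) with hA
  have hZA : ∀ z ∈ ZP m n, z ∈ A := fun z hz => A.algebraMap_mem (⟨z, hz⟩ : ZP m n)
  have hgl : ∀ j : Fin n, j < k →
      (seedUpTo hmn d (initSeed m n ρ B) k).x (Fin.castLE hmn j) ∈ A := fun j hj =>
    Algebra.subset_adjoin (Or.inl ⟨j, hj, hxlt j hj⟩)
  have hgg : ∀ j : Fin n, k < j → xv m (Fin.castLE hmn j) ∈ A := fun j hj =>
    Algebra.subset_adjoin (Or.inr ⟨j, hj, rfl⟩)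
  have hx0 : ∀ j : Fin m, (k : ℕ) ≤ j →
      (seedUpTo hmn d (initSeed m n ρ B) k).x j = xv m j := hxge
  set S := seedUpTo hmn d (initSeed m n ρ B) k with hS
  have hBii : S.B (Fin.castLE hmn i) k = B (Fin.castLE hmn i) k := by
    rw [hBs]
    have : ¬ (i : ℕ) < k := not_lt.2 (le_of_lt hki)
    simp [sg, this, initSeed]
  have hBnn : ∀ j : Fin n, 0 ≤ S.B (Fin.castLE hmn j) k := by
    intro j
    rw [hBs]
    rcases lt_trichotomy j k with h | h | h
    · have h' : (j : ℕ) < k := h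
      have := hneg j k h
      simp [sg, h', initSeed, this]
    · subst h
      simp [initSeed, hdiag]
    · have h' : ¬ (j : ℕ) < k := not_lt.2 (le_of_lt h)
      have := hord j k h
      simp [sg, h', initSeed, this]
  have hBkk : S.B (Fin.castLE hmn k) k = 0 := by
    rw [hBs]; simp [initSeed, hdiag]
  have hdk := hseed.d_pos k
  have hxk : S.x (Fin.castLE hmn k) = xv m (Fin.castLE hmn k) := hx0 _ le_rfl
  have hρk : S.ρ k = ρ k := hρ
  have hcast : ∀ j : Fin m, ∀ h : (j : ℕ) < n, Fin.castLE hmn ⟨j, h⟩ = j := fun j h => rfl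
  -- the zeroth term
  have hzero : S.ρ k 0 * ∏ j : Fin m, S.x j ^ mutExp (d k) (S.B j k) 0 =
      ∏ j ∈ Finset.univ.filter (fun j : Fin m => n ≤ (j : ℕ) ∧ S.B j k < 0),
            xv m j ^ (-S.B j k) := by
    rw [hρk, hseed.rho_zero, one_mul, Finset.prod_filter]
    refine Finset.prod_congr rfl fun j _ => ?_
    rw [mutExp_zero _ hdk]
    split_ifs with h
    · rw [hx0 j (by have := k.2; omega), max_eq_left (by omega)]
    · have : 0 ≤ S.B j k := by
        by_cases hj : (j : ℕ) < n
        · exact hBnn ⟨j, hj⟩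
        · by_contra h'
          exact h ⟨by omega, by omega⟩
      rw [max_eq_right (by omega), zpow_zero]
  rw [exchangeVar, hxk, mul_inv_cancel_left₀ (xv_ne_zero _ _), Finset.sum_range_succ', hzero,
    add_sub_cancel_right, Finset.mul_sum]
  refine sum_mem fun r hr => ?_
  have hr' : r + 1 ≤ d k := by simpa [Nat.succ_le_iff] using hr
  rw [mul_left_comm, hρk]
  refine mul_mem (hZA _ (frozenMonomial_mem (hseed.rho_mon k _ hr'))) ?_
  rw [← Finset.mul_prod_erase Finset.univ _ (Finset.mem_univ (Fin.castLE hmn i)), ← mul_assoc]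
  refine mul_mem ?_ (prod_mem fun j hj => ?_)
  · rw [hx0 _ (le_of_lt hki)]
    have h1 : 1 ≤ mutExp (d k) (S.B (Fin.castLE hmn i) k) (r + 1) := by
      rw [hBii]
      exact mutExp_pos _ hdk _ hbik (hseed.d_dvd k i) _ (by omega)
    obtain ⟨e, he⟩ := Int.eq_ofNat_of_zero_le (sub_nonneg.2 h1)
    have he' : mutExp (d k) (S.B (Fin.castLE hmn i) k) (r + 1) = ((e + 1 : ℕ) : ℤ) := by
      push_cast; omega
    rw [he', zpow_natCast, pow_succ', inv_mul_cancel_left₀ (xv_ne_zero _ _)]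
    exact pow_mem (hgg i hki) e
  · by_cases hjn : (j : ℕ) < n
    · obtain ⟨e, he⟩ := Int.eq_ofNat_of_zero_le (mutExp_nonneg (d k) (S.B j k) (r + 1))
      rcases lt_trichotomy (⟨j, hjn⟩ : Fin n) k with h | h | h
      · rw [he, zpow_natCast]
        exact pow_mem (hgl ⟨j, hjn⟩ h) e
      · have hj0 : S.B j k = 0 := by
          have : j = Fin.castLE hmn k := by rw [← h]; rfl
          rw [this]; exact hBkk
        have : mutExp (d k) (S.B j k) (r + 1) = 0 := by rw [hj0]; simp [mutExp]
        rw [this, zpow_zero]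
        exact one_mem _
      · rw [he, zpow_natCast, hx0 j (le_of_lt h)]
        exact pow_mem (hgg ⟨j, hjn⟩ h) e
    · rw [hx0 j (by have := k.2; omega)]
      exact hZA _ (frozen_zpow_mem j (not_lt.1 hjn) _)
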